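/- arXiv:1805.05071 — 2 statements merged into one kernel-verified Lean document; each statement's English description precedes it below -/
import Mathlib

section
/- Let Z_1, …, Z_n be i.i.d. real random variables such that there exist a, b ≥ 0 with Z_1 ≤ a almost surely and E[e^{−Z_1}] ≤ b, and set γ = √(e^a) (16 e^{−2} b + a²). Then Z_1 is integrable, and for all real u < E[Z_1]: if u ≤ E[Z_1] − γ/2 then P[ Σ_{i=1}^n Z_i ≤ n u ] ≤ exp(−n γ / 8); and if u > E[Z_1] − γ/2 then P[ Σ_{i=1}^n Z_i ≤ n u ] ≤ exp( −n (E[Z_1] − u)² / (2γ) ). -/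
open MeasureTheory ProbabilityTheory Real ENNReal
open scoped Classical

/-- `γ = √(e^a) (16 e⁻² b + a²)`. -/
noncomputable def gam (a b : ℝ) : ℝ :=
  Real.sqrt (Real.exp a) * (16 * Real.exp (-2) * b + a ^ 2)

lemma exp_upper_neg (x : ℝ) (hx : x ≤ 0) : Real.exp x ≤ 1 + x + x ^ 2 / 2 := by
  have h := Real.quadratic_le_exp_of_nonneg (x := -x) (by linarith)
  have h1 : Real.exp x * Real.exp (-x) = 1 := by rw [← Real.exp_add]; simp
  have h2 := Real.exp_pos x
  have h3 : Real.exp x * (1 + -x + (-x) ^ 2 / 2) ≤ 1 := by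
    exact (mul_le_mul_of_nonneg_left h h2.le).trans h1.le
  have hq : 0 < 1 + -x + (-x) ^ 2 / 2 := by nlinarith [sq_nonneg x]
  by_contra hc
  push Not at hc
  have h4 := mul_lt_mul_of_pos_right hc hq
  nlinarith [sq_nonneg (x ^ 2)]

lemma exp_upper_pos (x : ℝ) (hx : 0 ≤ x) :
    Real.exp x ≤ 1 + x + x ^ 2 / 2 * Real.exp x := by
  have hm : MonotoneOn (fun y : ℝ => (1 + y) * Real.exp (-y) - 1 + y ^ 2 / 2) (Set.Ici 0) := by
    have hd : ∀ y : ℝ, HasDerivAt (fun y : ℝ => (1 + y) * Real.exp (-y) - 1 + y ^ 2 / 2)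
        (y * (1 - Real.exp (-y))) y := by
      intro y
      have h1 : HasDerivAt (fun y : ℝ => Real.exp (-y)) (Real.exp (-y) * (-1)) y :=
        (hasDerivAt_neg y).exp
      have h2 : HasDerivAt (fun y : ℝ => 1 + y) 1 y := (hasDerivAt_id y).const_add 1
      have h3 : HasDerivAt (fun y : ℝ => y ^ 2 / 2) ((2 : ℕ) * y ^ (2 - 1) / 2) y :=
        (hasDerivAt_pow 2 y).div_const 2
      refine (((h2.mul h1).sub_const 1).add h3).congr_deriv ?_
      push_cast
      ring
    apply monotoneOn_of_deriv_nonneg (convex_Ici 0)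
    · exact fun y _ => (hd y).continuousAt.continuousWithinAt
    · exact fun y _ => (hd y).differentiableAt.differentiableWithinAt
    · intro y hy
      rw [interior_Ici] at hy
      have hy' : (0 : ℝ) < y := hy
      rw [(hd y).deriv]
      have : Real.exp (-y) ≤ 1 := Real.exp_le_one_iff.2 (by linarith)
      exact mul_nonneg hy'.le (by linarith)
  have h := hm (Set.mem_Ici.2 le_rfl) (Set.mem_Ici.2 hx) hx
  simp only [neg_zero, Real.exp_zero] at h
  have h1 : Real.exp x * Real.exp (-x) = 1 := by rw [← Real.exp_add]; simp
  have h2 := mul_le_mul_of_nonneg_left h (Real.exp_pos x).le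
  have h3 : Real.exp x * ((1 + x) * Real.exp (-x) - 1 + x ^ 2 / 2)
      = (1 + x) * (Real.exp x * Real.exp (-x)) - Real.exp x + x ^ 2 / 2 * Real.exp x := by ring
  rw [h3, h1] at h2
  linarith

lemma sq_exp_bound (y : ℝ) (hy : 0 ≤ y) :
    y ^ 2 * Real.exp (y / 2) ≤ 16 * Real.exp (-2) * Real.exp y := by
  have h := Real.add_one_le_exp (y / 4 - 1)
  have h1 : y ≤ 4 * Real.exp (y / 4 - 1) := by linarith
  have h2 : y ^ 2 ≤ (4 * Real.exp (y / 4 - 1)) ^ 2 := pow_le_pow_left₀ hy h1 2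
  calc y ^ 2 * Real.exp (y / 2) ≤ (4 * Real.exp (y / 4 - 1)) ^ 2 * Real.exp (y / 2) := by gcongr
    _ = 16 * (Real.exp (y / 4 - 1) * Real.exp (y / 4 - 1) * Real.exp (y / 2)) := by ring
    _ = 16 * (Real.exp (-2) * Real.exp y) := by
      rw [← Real.exp_add, ← Real.exp_add, ← Real.exp_add]; ring_nf
    _ = _ := by ring

lemma pointwise_bound (a z l : ℝ) (ha : 0 ≤ a) (hz : z ≤ a) (hl : 0 ≤ l) (hl2 : l ≤ 1 / 2) :
    Real.exp (-l * z) ≤ 1 - l * z + l ^ 2 / 2 * (16 * Real.exp (-2) * Real.exp (-z) + a ^ 2) := by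
  rcases le_total 0 z with h0 | h0
  · have h := exp_upper_neg (-l * z) (by nlinarith)
    have hp : 0 ≤ 16 * Real.exp (-2) * Real.exp (-z) := by positivity
    have hza : z ^ 2 ≤ a ^ 2 := pow_le_pow_left₀ h0 hz 2
    have := mul_le_mul_of_nonneg_left
      (show z ^ 2 ≤ 16 * Real.exp (-2) * Real.exp (-z) + a ^ 2 by linarith)
      (show 0 ≤ l ^ 2 / 2 by positivity)
    linarith [show (-l * z) ^ 2 / 2 = l ^ 2 / 2 * z ^ 2 by ring]
  · have h := exp_upper_pos (-l * z) (by nlinarith)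
    have hb := sq_exp_bound (-z) (by linarith)
    have he : Real.exp (-l * z) ≤ Real.exp (-z / 2) := Real.exp_le_exp.2 (by nlinarith)
    have h2 : z ^ 2 * Real.exp (-l * z) ≤ (-z) ^ 2 * Real.exp (-z / 2) := by
      rw [neg_sq]; gcongr
    have := mul_le_mul_of_nonneg_left
      (show z ^ 2 * Real.exp (-l * z) ≤ 16 * Real.exp (-2) * Real.exp (-z) + a ^ 2 by
        nlinarith [sq_nonneg a])
      (show 0 ≤ l ^ 2 / 2 by positivity)
    linarith [show (-l * z) ^ 2 / 2 * Real.exp (-l * z)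
      = l ^ 2 / 2 * (z ^ 2 * Real.exp (-l * z)) by ring]

/-- One-sided concentration: if `Z_1, …, Z_n` are i.i.d. with `Z_1 ≤ a` a.s. and
`E[e^{−Z_1}] ≤ b`, then `Z_1` is integrable and, for all `u < E[Z_1]`,
`P[∑ Z_i ≤ nu] ≤ exp(−nγ/8)` when `u ≤ E[Z_1] − γ/2`, and
`P[∑ Z_i ≤ nu] ≤ exp(−n(E[Z_1] − u)²/(2γ))` when `u > E[Z_1] − γ/2`. -/
theorem one_sided_concentration {Ω : Type*} [MeasurableSpace Ω]
    (P : Measure Ω) [IsProbabilityMeasure P]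
    (n : ℕ) (hn : 0 < n) (Z : Fin n → Ω → ℝ) (hmeas : ∀ i, Measurable (Z i))
    (hindep : iIndepFun Z P)
    (hident : ∀ i, IdentDistrib (Z i) (Z ⟨0, hn⟩) P P)
    (a b : ℝ) (ha : 0 ≤ a) (hb : 0 ≤ b)
    (hZa : ∀ᵐ ω ∂P, Z ⟨0, hn⟩ ω ≤ a)
    (hZb : ∫⁻ ω, ENNReal.ofReal (Real.exp (-(Z ⟨0, hn⟩ ω))) ∂P ≤ ENNReal.ofReal b) :
    Integrable (Z ⟨0, hn⟩) P ∧
    ∀ u : ℝ, u < ∫ ω, Z ⟨0, hn⟩ ω ∂P →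
      ((u ≤ (∫ ω, Z ⟨0, hn⟩ ω ∂P) - gam a b / 2 →
        P {ω | ∑ i : Fin n, Z i ω ≤ n * u}
          ≤ ENNReal.ofReal (Real.exp (-(n * gam a b) / 8))) ∧
      ((∫ ω, Z ⟨0, hn⟩ ω ∂P) - gam a b / 2 < u →
        P {ω | ∑ i : Fin n, Z i ω ≤ n * u}
          ≤ ENNReal.ofReal
              (Real.exp (-(n * ((∫ ω, Z ⟨0, hn⟩ ω ∂P) - u) ^ 2) / (2 * gam a b))))) := by
  set X := Z ⟨0, hn⟩ with hX
  have hXm : Measurable X := hmeas _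
  have hexpI : Integrable (fun ω => Real.exp (-(X ω))) P := by
    refine ⟨(hXm.neg.exp).aestronglyMeasurable, ?_⟩
    rw [hasFiniteIntegral_iff_ofReal (Filter.Eventually.of_forall fun ω => (Real.exp_pos _).le)]
    exact lt_of_le_of_lt hZb ENNReal.ofReal_lt_top
  have hexpb : ∫ ω, Real.exp (-(X ω)) ∂P ≤ b := by
    rw [integral_eq_lintegral_of_nonneg_ae
      (Filter.Eventually.of_forall fun ω => (Real.exp_pos _).le)
      hexpI.aestronglyMeasurable]
    exact ENNReal.toReal_le_of_le_ofReal hb hZb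
  have hI : Integrable X P := by
    refine Integrable.mono' (hexpI.add (integrable_const a)) hXm.aestronglyMeasurable ?_
    filter_upwards [hZa] with ω hω
    simp only [Pi.add_apply, Real.norm_eq_abs]
    have h1 := Real.add_one_le_exp (-(X ω))
    have h2 := Real.exp_pos (-(X ω))
    exact abs_le'.2 ⟨by linarith, by linarith⟩
  refine ⟨hI, ?_⟩
  set m := ∫ ω, X ω ∂P with hm
  set v := 16 * Real.exp (-2) * b + a ^ 2 with hv
  have hv0 : 0 ≤ v := by positivity
  have hvg : v ≤ gam a b := by
    have : 1 ≤ Real.sqrt (Real.exp a) := Real.one_le_sqrt.2 (Real.one_le_exp ha)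
    unfold gam
    nlinarith
  -- Chernoff bound
  have key : ∀ l : ℝ, 0 ≤ l → l ≤ 1 / 2 → ∀ u : ℝ,
      P {ω | ∑ i : Fin n, Z i ω ≤ n * u}
        ≤ ENNReal.ofReal (Real.exp (n * (l * u - l * m + l ^ 2 / 2 * gam a b))) := by
    intro l hl hl2 u
    have hbdI : Integrable (fun ω => 1 - l * X ω +
        l ^ 2 / 2 * (16 * Real.exp (-2) * Real.exp (-(X ω)) + a ^ 2)) P :=
      ((integrable_const 1).sub (hI.const_mul l)).add
        (((hexpI.const_mul _).add (integrable_const _)).const_mul _)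
    have hpt : ∀ᵐ ω ∂P, Real.exp (-l * X ω) ≤ 1 - l * X ω +
        l ^ 2 / 2 * (16 * Real.exp (-2) * Real.exp (-(X ω)) + a ^ 2) := by
      filter_upwards [hZa] with ω hω
      exact pointwise_bound a _ l ha hω hl hl2
    have hEI : Integrable (fun ω => Real.exp (-l * X ω)) P := by
      refine Integrable.mono' hbdI (hXm.const_mul (-l)).exp.aestronglyMeasurable ?_
      filter_upwards [hpt] with ω hω
      rwa [Real.norm_eq_abs, abs_of_pos (Real.exp_pos _)]
    have hmgf : mgf X P (-l) ≤ Real.exp (-l * m + l ^ 2 / 2 * gam a b) := by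
      have h1 : mgf X P (-l) ≤ _ := integral_mono_ae hEI hbdI hpt
      have h2 : ∫ ω, (1 - l * X ω +
          l ^ 2 / 2 * (16 * Real.exp (-2) * Real.exp (-(X ω)) + a ^ 2)) ∂P
          = 1 - l * m + l ^ 2 / 2 *
            (16 * Real.exp (-2) * ∫ ω, Real.exp (-(X ω)) ∂P + a ^ 2) := by
        have i1 : Integrable (fun ω => l * X ω) P := hI.const_mul l
        have i2 : Integrable (fun ω => 1 - l * X ω) P := (integrable_const 1).sub i1
        have i3 : Integrable (fun ω => 16 * Real.exp (-2) * Real.exp (-(X ω))) P :=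
          hexpI.const_mul _
        have i4 : Integrable (fun ω => l ^ 2 / 2 *
            (16 * Real.exp (-2) * Real.exp (-(X ω)) + a ^ 2)) P :=
          (i3.add (integrable_const _)).const_mul _
        rw [integral_add i2 i4, integral_sub (integrable_const 1) i1, integral_const_mul,
          integral_const_mul, integral_add i3 (integrable_const _), integral_const_mul]
        simp [hm]
      have h3 : 16 * Real.exp (-2) * ∫ ω, Real.exp (-(X ω)) ∂P + a ^ 2 ≤ gam a b := by
        refine le_trans ?_ hvg
        rw [hv]; gcongr
      have h4 : l ^ 2 / 2 * (16 * Real.exp (-2) * ∫ ω, Real.exp (-(X ω)) ∂P + a ^ 2)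
          ≤ l ^ 2 / 2 * gam a b := mul_le_mul_of_nonneg_left h3 (by positivity)
      have h5 := Real.add_one_le_exp (-l * m + l ^ 2 / 2 * gam a b)
      linarith
    have hEIi : ∀ i, Integrable (fun ω => Real.exp (-l * Z i ω)) P := fun i =>
      (((hident i).comp (u := fun x => Real.exp (-l * x)) (by fun_prop)).integrable_iff).2 hEI
    have hmi : ∀ i, mgf (Z i) P (-l) = mgf X P (-l) := fun i =>
      ((hident i).comp (u := fun x => Real.exp (-l * x)) (by fun_prop)).integral_eq
    have hsumI : Integrable (fun ω => Real.exp (-l * (∑ i, Z i) ω)) P :=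
      hindep.integrable_exp_mul_sum hmeas (fun i _ => hEIi i)
    have hch := measure_le_le_exp_mul_mgf (μ := P) (X := ∑ i, Z i) (n * u)
      (t := -l) (by linarith) hsumI
    rw [hindep.mgf_sum hmeas, Finset.prod_congr rfl (fun i _ => hmi i), Finset.prod_const,
      Finset.card_univ, Fintype.card_fin] at hch
    have hset : {ω | ∑ i : Fin n, Z i ω ≤ n * u} = {ω | (∑ i, Z i) ω ≤ n * u} := by
      ext ω; simp
    rw [hset, ← ofReal_measureReal (μ := P)]
    apply ENNReal.ofReal_le_ofReal
    refine hch.trans ?_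
    calc Real.exp (-(-l) * (n * u)) * mgf X P (-l) ^ n
        ≤ Real.exp (-(-l) * (n * u)) * Real.exp (-l * m + l ^ 2 / 2 * gam a b) ^ n := by
          gcongr
          exact mgf_nonneg
      _ = _ := by
          rw [← Real.exp_nat_mul, ← Real.exp_add]; ring_nf
  intro u hu
  have hn0 : (0 : ℝ) ≤ n := Nat.cast_nonneg n
  constructor
  · intro h
    refine (key (1 / 2) (by norm_num) le_rfl u).trans ?_
    apply ENNReal.ofReal_le_ofReal
    apply Real.exp_le_exp.2
    have := mul_le_mul_of_nonneg_left
      (show 1 / 2 * u - 1 / 2 * m + (1 / 2) ^ 2 / 2 * gam a b ≤ - gam a b / 8 by linarith) hn0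
    linarith
  · intro h
    have hg : 0 < gam a b := by linarith
    refine (key ((m - u) / gam a b) (div_nonneg (by linarith) hg.le)
      (by rw [div_le_iff₀ hg]; linarith) u).trans ?_
    apply ENNReal.ofReal_le_ofReal
    apply Real.exp_le_exp.2
    apply le_of_eq
    field_simp
    ring
end

section
/- Let X_1, X_2, … be i.i.d. random variables with distribution ν on [0,1] such that E(ν) ∈ (0,1), let ν̂_m = (1/m) Σ_{i=1}^m δ_{X_i} denote their empirical distributions, let x ∈ (0, E(ν)), and let K, T be integers with 1 ≤ K ≤ T. Then P[ ∃ m ∈ {1, …, ⌊T/K⌋} : K_inf( ν̂_m, E(ν) − x ) > (1/m) ln( T/(K m) ) ] ≤ (e K / T) · 5 / (1 − e^{−2 x²})³. -/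
open MeasureTheory ProbabilityTheory Real ENNReal
open scoped Classical

/-- Kullback–Leibler divergence between two measures on `ℝ`, equal to
`∫ ln(dν/dν') dν` when `ν ≪ ν'` (and this integral is well defined), and `+∞` otherwise. -/
noncomputable def KL (ν ν' : Measure ℝ) : ℝ≥0∞ :=
  if ν ≪ ν' ∧ Integrable (fun x => Real.log ((ν.rnDeriv ν' x).toReal)) ν
  then ENNReal.ofReal (∫ x, Real.log ((ν.rnDeriv ν' x).toReal) ∂ν)
  else ⊤

/-- `K_inf(ν, x)`: infimum of `KL(ν, ν')` over probability measures `ν'` on `[0,1]`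
with mean `> x`. The infimum of the empty set is `+∞`. -/
noncomputable def Kinf (ν : Measure ℝ) (x : ℝ) : ℝ≥0∞ :=
  ⨅ (ν' : Measure ℝ) (_ : IsProbabilityMeasure ν')
    (_ : ν' (Set.Icc (0:ℝ) 1)ᶜ = 0) (_ : x < ∫ y, y ∂ν'), KL ν ν'

/-- The empirical distribution `(1/m) ∑_{i=1}^m δ_{X_i(ω)}` of the first `m` random
variables of a sequence. -/
noncomputable def empSeq {Ω : Type*} (X : ℕ → Ω → ℝ) (m : ℕ) (ω : Ω) : Measure ℝ :=
  (m : ℝ≥0∞)⁻¹ • ∑ i ∈ Finset.range m, Measure.dirac (X i ω)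

lemma kmd_KL_le (ρ ρ' : Measure ℝ) [IsProbabilityMeasure ρ] [IsProbabilityMeasure ρ']
    (hall : ∀ f : ℝ → ℝ, Measurable f → Integrable f ρ)
    (w : ℝ → ℝ) (hw : Measurable w) (hpos : ∀ᵐ y ∂ρ, 0 < w y)
    (hle : ρ.withDensity (fun y => ENNReal.ofReal (w y)) ≤ ρ') :
    KL ρ ρ' ≤ ENNReal.ofReal (∫ y, - Real.log (w y) ∂ρ) := by
  set h : ℝ → ℝ≥0∞ := fun y => ENNReal.ofReal (w y) with hh
  have hhm : Measurable h := hw.ennreal_ofReal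
  have h0 : ∀ᵐ y ∂ρ, h y ≠ 0 := by
    filter_upwards [hpos] with y hy
    simpa [hh] using hy
  have hinv : (ρ.withDensity h).withDensity (fun y => (h y)⁻¹) = ρ :=
    withDensity_inv_same hhm h0 (by simp [hh])
  have hle2 : ρ ≤ ρ'.withDensity (fun y => (h y)⁻¹) := by
    conv_lhs => rw [← hinv]
    refine Measure.le_iff.2 fun s hs => ?_
    rw [withDensity_apply _ hs, withDensity_apply _ hs]
    exact lintegral_mono' (Measure.restrict_mono le_rfl hle) le_rfl
  have hac : ρ ≪ ρ' := (Measure.absolutelyContinuous_of_le hle2).trans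
    (withDensity_absolutelyContinuous _ _)
  have hrn : ρ.rnDeriv ρ' ≤ᵐ[ρ'] fun y => (h y)⁻¹ := by
    refine ae_le_of_forall_setLIntegral_le_of_sigmaFinite (Measure.measurable_rnDeriv _ _) ?_
    intro s hs _
    refine (Measure.setLIntegral_rnDeriv_le s).trans ?_
    rw [← withDensity_apply _ hs]
    exact hle2 s
  have hi : Integrable (fun x => Real.log ((ρ.rnDeriv ρ' x).toReal)) ρ := by
    apply hall
    exact Real.measurable_log.comp (Measure.measurable_rnDeriv _ _).ennreal_toReal
  unfold KL
  rw [if_pos ⟨hac, hi⟩]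
  apply ENNReal.ofReal_le_ofReal
  apply integral_mono_ae hi (hall _ (Real.measurable_log.comp hw).neg)
  filter_upwards [hac.ae_le hrn, Measure.rnDeriv_pos hac, hpos] with y h1 h2 h3
  change _ ≤ - Real.log (w y)
  rw [← Real.log_inv]
  have h4 : (h y)⁻¹ = ENNReal.ofReal ((w y)⁻¹) := by
    simp [hh, ENNReal.ofReal_inv_of_pos h3]
  rw [h4] at h1
  apply Real.log_le_log
  · exact ENNReal.toReal_pos h2.ne' (ne_top_of_le_ne_top ENNReal.ofReal_ne_top h1)
  · have := ENNReal.toReal_mono ENNReal.ofReal_ne_top h1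
    rwa [ENNReal.toReal_ofReal (inv_pos.2 h3).le] at this

lemma kmd_Kinf_le (ρ : Measure ℝ) [IsProbabilityMeasure ρ] (hs : ρ (Set.Icc (0:ℝ) 1)ᶜ = 0)
    (hall : ∀ f : ℝ → ℝ, Measurable f → Integrable f ρ)
    (w : ℝ → ℝ) (hw : Measurable w) (hpos : ∀ᵐ y ∂ρ, 0 < w y)
    (r c : ℝ) (hr : 0 ≤ r) (hone : ∫ y, w y ∂ρ + r = 1) (hc : c < ∫ y, w y * y ∂ρ + r) :
    Kinf ρ c ≤ ENNReal.ofReal (∫ y, - Real.log (w y) ∂ρ) := by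
  set h : ℝ → ℝ≥0∞ := fun y => ENNReal.ofReal (w y) with hh
  have hhm : Measurable h := hw.ennreal_ofReal
  set ρ' : Measure ℝ := ρ.withDensity h + ENNReal.ofReal r • Measure.dirac 1 with hρ'
  have hw0 : 0 ≤ᵐ[ρ] w := by filter_upwards [hpos] with y hy using hy.le
  have hwi : 0 ≤ ∫ y, w y ∂ρ := integral_nonneg_of_ae hw0
  have hP : IsProbabilityMeasure ρ' := by
    constructor
    simp only [hρ', Measure.add_apply, Measure.smul_apply, withDensity_apply _ MeasurableSet.univ,
      Measure.restrict_univ, hh]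
    rw [← ofReal_integral_eq_lintegral_ofReal (hall w hw) hw0]
    simp only [measure_univ, smul_eq_mul, mul_one]
    rw [← ENNReal.ofReal_add hwi hr, hone]; simp
  have hsupp : ρ' (Set.Icc (0:ℝ) 1)ᶜ = 0 := by
    have h1 : ρ.withDensity h (Set.Icc (0:ℝ) 1)ᶜ = 0 :=
      withDensity_absolutelyContinuous _ _ hs
    simp [hρ', h1]
  have hfin : IsFiniteMeasure (ρ.withDensity h) := by
    apply isFiniteMeasure_withDensity_ofReal
    exact (hall w hw).2
  have hi1 : Integrable (fun y : ℝ => y) (ρ.withDensity h) := by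
    rw [integrable_withDensity_iff_integrable_smul' hhm (by simp [hh])]
    apply hall
    exact hhm.ennreal_toReal.mul measurable_id
  have hi2 : Integrable (fun y : ℝ => y) (ENNReal.ofReal r • Measure.dirac (1:ℝ)) := by
    apply Integrable.smul_measure _ ENNReal.ofReal_ne_top
    exact integrable_dirac (by simp)
  have hmean : ∫ y, y ∂ρ' = ∫ y, w y * y ∂ρ + r := by
    rw [hρ', integral_add_measure hi1 hi2, integral_smul_measure, integral_dirac,
      integral_withDensity_eq_integral_toReal_smul hhm (by simp [hh])]
    simp only [smul_eq_mul, mul_one, ENNReal.toReal_ofReal hr]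
    congr 1
    apply integral_congr_ae
    filter_upwards [hpos] with y hy
    simp [hh, hy.le]
  refine le_trans (iInf₂_le_of_le ρ' hP (iInf₂_le hsupp (by rw [hmean]; exact hc))) ?_
  exact kmd_KL_le ρ ρ' hall w hw hpos (by rw [hρ']; exact Measure.le_add_right le_rfl)

/-- binary Pinsker -/
lemma kmd_pinsker (p s : ℝ) (hp : 0 ≤ p) (hps : p ≤ s) (hs : s < 1) :
    2 * (s - p) ^ 2 ≤ (1 - p) * Real.log ((1 - p) / (1 - s)) + p * Real.log (p / s) := by
  set f : ℝ → ℝ := fun t => -((1 - p) * Real.log (1 - t)) - p * Real.log t - 2 * (t - p) ^ 2 with hf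
  have hmono : MonotoneOn f (Set.Icc p s) := by
    apply monotoneOn_of_hasDerivWithinAt_nonneg (convex_Icc p s)
      (f' := fun t => -((1 - p) * (-1 / (1 - t))) - p * (1 / t) - 2 * (2 * (t - p)))
    · have h1 : ContinuousOn (fun t : ℝ => -((1 - p) * Real.log (1 - t))) (Set.Icc p s) := by
        apply ContinuousOn.neg
        apply ContinuousOn.mul continuousOn_const
        apply ContinuousOn.log (by fun_prop)
        intro t ht; have := ht.2; linarith
      have h2 : ContinuousOn (fun t : ℝ => p * Real.log t) (Set.Icc p s) := by
        rcases hp.eq_or_lt with h | h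
        · simp [← h]; exact continuousOn_const
        · apply ContinuousOn.mul continuousOn_const
          apply ContinuousOn.log (by fun_prop)
          intro t ht; have := ht.1; linarith
      exact (h1.sub h2).sub (by fun_prop)
    · intro t ht
      rw [interior_Icc] at ht
      have ht0 : t ≠ 0 := by have := ht.1; linarith
      have ht1 : 1 - t ≠ 0 := by have := ht.2; linarith
      apply HasDerivAt.hasDerivWithinAt
      have a1 := (((hasDerivAt_id t).const_sub 1).log ht1).const_mul (1 - p)
      have a2 := ((hasDerivAt_id t).log ht0).const_mul p
      have a3 := ((((hasDerivAt_id t).sub_const p).pow 2).const_mul 2)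
      convert (a1.neg.sub a2).sub a3 using 1
      · ext y; simp [hf]
      · simp
    · intro t ht
      rw [interior_Icc] at ht
      have ht0 : 0 < t := by have := ht.1; linarith
      have ht1 : 0 < 1 - t := by have := ht.2; linarith
      have : -((1 - p) * (-1 / (1 - t))) - p * (1 / t) - 2 * (2 * (t - p))
        = (t - p) * (1 - 2 * t) ^ 2 / (t * (1 - t)) := by field_simp; ring
      rw [this]
      have := ht.1
      have : 0 ≤ t - p := by linarith
      positivity
  have h := hmono (Set.left_mem_Icc.2 hps) (Set.right_mem_Icc.2 hps) hps
  simp only [hf] at h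
  rw [Real.log_div (by linarith) (by linarith)]
  have h3 : p * Real.log (p / s) = p * (Real.log p - Real.log s) := by
    rcases hp.eq_or_lt with h | h
    · simp [← h]
    · rw [Real.log_div (by linarith) (by linarith)]
  rw [h3]
  nlinarith

/-- Cover's universal bound -/
lemma kmd_cover (m : ℕ) (b : ℕ → ℝ) (hb : ∀ i, i < m → 0 ≤ b i) (l : ℝ) (h0 : 0 ≤ l) (h1 : l ≤ 1) :
    ∏ i ∈ Finset.range m, (l * b i + (1 - l))
      ≤ ∑ S ∈ (Finset.range m).powerset, ((m.choose S.card : ℝ))⁻¹ * ∏ i ∈ S, b i := by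
  rw [Finset.prod_add]
  apply Finset.sum_le_sum
  intro S hS
  rw [Finset.mem_powerset] at hS
  have hcard : S.card ≤ m := by simpa using Finset.card_le_card hS
  rw [Finset.prod_mul_distrib, Finset.prod_const, Finset.prod_const, Finset.card_sdiff_of_subset hS,
    Finset.card_range]
  have hprod : 0 ≤ ∏ i ∈ S, b i := Finset.prod_nonneg fun i hi => hb i (by simpa using hS hi)
  have hch : 0 < (m.choose S.card : ℝ) := by exact_mod_cast Nat.choose_pos hcard
  have key : l ^ S.card * (1 - l) ^ (m - S.card) * (m.choose S.card : ℝ) ≤ 1 := by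
    have := add_pow l (1 - l) m
    rw [add_sub_cancel, one_pow] at this
    refine le_of_le_of_eq ?_ this.symm
    refine Finset.single_le_sum (s := Finset.range (m + 1)) (a := S.card) (f := fun k => l ^ k * (1 - l) ^ (m - k) * (m.choose k : ℝ)) ?_
      (Finset.mem_range.2 (by omega))
    intro k _
    have : 0 ≤ 1 - l := by linarith
    positivity
  have : l ^ S.card * (1 - l) ^ (m - S.card) ≤ (m.choose S.card : ℝ)⁻¹ := by
    rw [← one_div, le_div_iff₀ hch]; exact key
  nlinarith

lemma kmd_sum_choose (m : ℕ) :
    ∑ S ∈ (Finset.range m).powerset, ((m.choose S.card : ℝ))⁻¹ = m + 1 := by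
  rw [Finset.sum_powerset_apply_card (fun k => ((m.choose k : ℝ))⁻¹)]
  rw [Finset.card_range]
  rw [Finset.sum_congr rfl (g := fun _ => (1:ℝ))]
  · simp
  · intro k hk
    have : 0 < m.choose k := Nat.choose_pos (by simp at hk; omega)
    rw [nsmul_eq_mul, mul_inv_cancel₀]
    positivity

lemma kmd_sum_geom (q : ℝ) (h0 : 0 ≤ q) (h1 : q < 1) (N : ℕ) :
    ∑ m ∈ Finset.Icc 1 N, ((m:ℝ) + 1) * m * q ^ m ≤ 2 / (1 - q) ^ 3 := by
  have hq : ‖q‖ < 1 := by rwa [Real.norm_of_nonneg h0]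
  have h := hasSum_choose_mul_geometric_of_norm_lt_one 2 hq
  have h2 := sum_le_hasSum (Finset.Icc 1 N) (fun i _ => by positivity) h
  calc _ ≤ ∑ m ∈ Finset.Icc 1 N, 2 * (((m + 2).choose 2 : ℝ) * q ^ m) := by
        apply Finset.sum_le_sum
        intro m _
        rw [Nat.cast_choose_two]
        push_cast
        have : 0 ≤ q ^ m := by positivity
        nlinarith [mul_nonneg (Nat.cast_nonneg (α := ℝ) m) this]
    _ ≤ 2 * (1 / (1 - q) ^ (2 + 1)) := by
        rw [← Finset.mul_sum]; linarith
    _ = _ := by ring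

/-- empirical measure of `m` points -/
noncomputable def kmdEmp (a : ℕ → ℝ) (m : ℕ) : Measure ℝ :=
  (m : ℝ≥0∞)⁻¹ • ∑ i ∈ Finset.range m, Measure.dirac (a i)

lemma kmdEmp_prob (a : ℕ → ℝ) (m : ℕ) (hm : 1 ≤ m) : IsProbabilityMeasure (kmdEmp a m) := by
  constructor
  simp only [kmdEmp, Measure.smul_apply, Measure.coe_finsetSum, Finset.sum_apply, measure_univ]
  simp only [Finset.sum_const, Finset.card_range, smul_eq_mul, nsmul_eq_mul, mul_one]
  exact ENNReal.inv_mul_cancel (by simp; omega) (by simp)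

lemma kmdEmp_integrable (a : ℕ → ℝ) (m : ℕ) (hm : 1 ≤ m) (f : ℝ → ℝ) :
    Integrable f (kmdEmp a m) := by
  apply Integrable.smul_measure
  · rw [integrable_finsetSum_measure]
    intro i _
    exact integrable_dirac (by simp)
  · simp; omega

lemma kmdEmp_integral (a : ℕ → ℝ) (m : ℕ) (f : ℝ → ℝ) :
    ∫ y, f y ∂(kmdEmp a m) = (∑ i ∈ Finset.range m, f (a i)) / m := by
  rw [kmdEmp, integral_smul_measure, integral_finsetSum_measure]
  · simp [div_eq_inv_mul]
  · intro i _
    exact integrable_dirac (by simp)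

lemma kmdEmp_ae (a : ℕ → ℝ) (m : ℕ) (p : ℝ → Prop) (h : ∀ i, i < m → p (a i)) :
    ∀ᵐ y ∂(kmdEmp a m), p y := by
  apply Measure.ae_smul_measure
  rw [ae_iff, Measure.coe_finsetSum, Finset.sum_apply]
  apply Finset.sum_eq_zero
  intro i hi
  rw [← ae_iff, ae_dirac_eq]
  exact h i (by simpa using hi)

/-- existence of the optimal `l` with first-order conditions -/
lemma kmd_opt (m : ℕ) (d : ℕ → ℝ) (hd : ∀ i, i < m → -1 ≤ d i)
    (hsum : 0 < ∑ i ∈ Finset.range m, d i) :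
    ∃ l : ℝ, 0 < l ∧ l ≤ 1 ∧ (∀ i, i < m → 0 < 1 + l * d i) ∧
      (∀ y ∈ Set.Icc (0:ℝ) 1, ∏ i ∈ Finset.range m, (1 + y * d i)
        ≤ ∏ i ∈ Finset.range m, (1 + l * d i)) ∧
      0 ≤ ∑ i ∈ Finset.range m, d i / (1 + l * d i) ∧
      (l - 1) * ∑ i ∈ Finset.range m, d i / (1 + l * d i) = 0 := by
  set F : ℝ → ℝ := fun y => ∏ i ∈ Finset.range m, (1 + y * d i) with hF
  have hcont : Continuous F := by fun_prop
  obtain ⟨l, hl, hmax⟩ := (isCompact_Icc (a := (0:ℝ)) (b := 1)).exists_isMaxOn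
    ⟨0, by simp⟩ hcont.continuousOn
  have hFl : 1 ≤ F l := by
    have := hmax (show (0:ℝ) ∈ Set.Icc (0:ℝ) 1 by simp)
    simpa [hF] using this
  have hpos : ∀ i, i < m → 0 < 1 + l * d i := by
    intro i hi
    have h0 : 0 ≤ 1 + l * d i := by nlinarith [hd i hi, hl.1, hl.2]
    rcases h0.eq_or_lt with h | h
    · exfalso
      have : F l = 0 := Finset.prod_eq_zero (Finset.mem_range.2 hi) h.symm
      linarith
    · exact h
  have hder : HasDerivAt F (F l * ∑ i ∈ Finset.range m, d i / (1 + l * d i)) l := by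
    have := HasDerivAt.fun_finsetProd (u := Finset.range m) (f := fun i y => 1 + y * d i)
      (f' := fun i => d i) (x := l) (fun i _ => by
        simpa using ((hasDerivAt_id l).mul_const (d i)).const_add 1)
    refine this.congr_deriv ?_
    symm
    rw [Finset.mul_sum]
    apply Finset.sum_congr rfl
    intro i hi
    have hp := hpos i (by simpa using hi)
    simp only [hF, smul_eq_mul]
    rw [← Finset.mul_prod_erase _ _ hi]
    field_simp
  set S := ∑ i ∈ Finset.range m, d i / (1 + l * d i) with hS
  have hfo : ∀ y ∈ Set.Icc (0:ℝ) 1, (y - l) * S ≤ 0 := by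
    intro y hy
    have h1 := (hmax.localize).hasFDerivWithinAt_nonpos hder.hasFDerivAt.hasFDerivWithinAt
      (sub_mem_posTangentConeAt_of_segment_subset ((convex_Icc (0:ℝ) 1).segment_subset hl hy))
    simp at h1
    by_contra hcon
    push Not at hcon
    have : 0 < (y - l) * (F l * S) := by
      have : (y - l) * (F l * S) = F l * ((y - l) * S) := by ring
      rw [this]; positivity
    linarith
  have hl0 : 0 < l := by
    rcases hl.1.eq_or_lt with h | h
    · exfalso
      have := hfo 1 (by simp)
      rw [hS, ← h] at this
      simp at this
      linarith
    · exact h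
  have hS0 : 0 ≤ S := by
    have := hfo 0 (by simp)
    by_contra hc
    push Not at hc
    nlinarith
  refine ⟨l, hl0, hl.2, hpos, fun y hy => hmax hy, hS0, ?_⟩
  have h1 := hfo 1 (by simp)
  have : (l - 1) * S ≤ 0 := by
    have := hl.2
    nlinarith
  linarith

lemma kmd_pinsker_prod (m : ℕ) (hm : 1 ≤ m) (a : ℕ → ℝ) (ha : ∀ i, i < m → a i ∈ Set.Icc (0:ℝ) 1)
    (μ p : ℝ) (hμ0 : 0 < μ) (hμ1 : μ < 1) (hp : ∑ i ∈ Finset.range m, a i = m * p) (hpμ : p ≤ μ) :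
    ∃ y ∈ Set.Icc (0:ℝ) 1, Real.exp (m * (2 * (μ - p) ^ 2))
      ≤ ∏ i ∈ Finset.range m, (1 + y * ((μ - a i) / (1 - μ))) := by
  have hm0 : (0:ℝ) < m := by exact_mod_cast hm
  have h1μ : 0 < 1 - μ := by linarith
  have hp0 : 0 ≤ p := by
    have : 0 ≤ (m:ℝ) * p := by
      rw [← hp]; exact Finset.sum_nonneg fun i hi => (ha i (by simpa using hi)).1
    by_contra h; push Not at h; nlinarith
  have hB : 0 < (1 - p) / (1 - μ) := div_pos (by linarith) h1μ
  refine ⟨(μ - p) / μ, ⟨div_nonneg (by linarith) hμ0.le, (div_le_one hμ0).2 (by linarith)⟩, ?_⟩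
  have hfac : ∀ t : ℝ, 1 + (μ - p) / μ * ((μ - t) / (1 - μ))
      = (1 - t) * ((1 - p) / (1 - μ)) + t * (p / μ) := by
    intro t; field_simp; ring
  have key : ∀ i ∈ Finset.range m, Real.exp ((1 - a i) * Real.log ((1 - p) / (1 - μ))
      + a i * Real.log (p / μ)) ≤ 1 + (μ - p) / μ * ((μ - a i) / (1 - μ)) := by
    intro i hi
    have hai := ha i (by simpa using hi)
    rw [hfac]
    rcases hp0.eq_or_lt with h | h
    · have h0 : a i = 0 := by
        rw [← h, mul_zero] at hp
        exact (Finset.sum_eq_zero_iff_of_nonneg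
          (fun j hj => (ha j (by simpa using hj)).1)).1 hp i hi
      simp only [h0, sub_zero, one_mul, zero_mul, add_zero]
      rw [Real.exp_log hB]
    · have hC : 0 < p / μ := div_pos h hμ0
      have hc := strictConcaveOn_log_Ioi.concaveOn.2 (Set.mem_Ioi.2 hB) (Set.mem_Ioi.2 hC)
        (sub_nonneg.2 hai.2) hai.1 (by ring)
      simp only [smul_eq_mul] at hc
      have hpos : 0 < (1 - a i) * ((1 - p) / (1 - μ)) + a i * (p / μ) := by
        rcases hai.1.eq_or_lt with h' | h'
        · rw [← h']; simpa using hB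
        · have : 0 ≤ 1 - a i := sub_nonneg.2 hai.2
          positivity
      rw [← Real.exp_log hpos]
      exact Real.exp_le_exp.2 hc
  refine le_trans ?_ (Finset.prod_le_prod (fun i _ => (Real.exp_pos _).le) key)
  rw [← Real.exp_sum]
  apply Real.exp_le_exp.2
  rw [Finset.sum_add_distrib, ← Finset.sum_mul, ← Finset.sum_mul, Finset.sum_sub_distrib, hp]
  have := kmd_pinsker p μ hp0 hpμ hμ1
  simp only [Finset.sum_const, Finset.card_range, nsmul_eq_mul, mul_one]
  nlinarith

lemma kmd_det (m : ℕ) (hm : 1 ≤ m) (a : ℕ → ℝ) (ha : ∀ i, i < m → a i ∈ Set.Icc (0:ℝ) 1)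
    (μ x u : ℝ) (hμ1 : μ < 1) (hx0 : 0 < x) (hxμ : x < μ) (hu : 0 ≤ u)
    (hK : ENNReal.ofReal u < Kinf (kmdEmp a m) (μ - x)) :
    ∃ l ∈ Set.Icc (0:ℝ) 1, Real.exp (m * (u + 2 * x ^ 2))
      ≤ ∏ i ∈ Finset.range m, (1 + l * ((μ - a i) / (1 - μ))) := by
  have hm0 : (0:ℝ) < m := by exact_mod_cast hm
  have h1μ : 0 < 1 - μ := by linarith
  have hμ0 : 0 < μ := by linarith
  have := kmdEmp_prob a m hm
  set p := (∑ i ∈ Finset.range m, a i) / m with hp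
  have hpm : ∑ i ∈ Finset.range m, a i = m * p := by rw [hp]; field_simp
  have hs : kmdEmp a m (Set.Icc (0:ℝ) 1)ᶜ = 0 := kmdEmp_ae a m (fun y => y ∈ Set.Icc (0:ℝ) 1) ha
  have hall : ∀ f : ℝ → ℝ, Measurable f → Integrable f (kmdEmp a m) :=
    fun f _ => kmdEmp_integrable a m hm f
  by_cases hpc : μ - x < p
  · exfalso
    have := kmd_Kinf_le (kmdEmp a m) hs hall (fun _ => 1) measurable_const (by simp) 0 (μ - x)
      le_rfl (by simp) (by simpa [kmdEmp_integral] using hpc)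
    simp at this
    rw [this] at hK
    simp at hK
  push Not at hpc
  set d : ℕ → ℝ := fun i => (μ - a i) / (1 - μ) with hd
  have hdi : ∀ i, i < m → -1 ≤ d i := by
    intro i hi
    rw [hd]; simp only
    rw [le_div_iff₀ h1μ]
    linarith [(ha i hi).2]
  have hdsum : ∑ i ∈ Finset.range m, d i = m * (μ - p) / (1 - μ) := by
    simp only [hd]
    rw [← Finset.sum_div, Finset.sum_sub_distrib, hpm]
    simp; ring
  obtain ⟨l, hl0, hl1, hpos, hmax, hS, hS2⟩ := kmd_opt m d hdi (by
    rw [hdsum]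
    have : 0 < μ - p := by linarith
    positivity)
  refine ⟨l, ⟨hl0.le, hl1⟩, ?_⟩
  set S := ∑ i ∈ Finset.range m, d i / (1 + l * d i) with hSdef
  set g := (∑ i ∈ Finset.range m, Real.log (1 + l * d i)) / m with hg
  have hFg : ∏ i ∈ Finset.range m, (1 + l * d i) = Real.exp (m * g) := by
    have : m * g = ∑ i ∈ Finset.range m, Real.log (1 + l * d i) := by rw [hg]; field_simp
    rw [this, Real.exp_sum]
    apply Finset.prod_congr rfl
    intro i hi
    rw [Real.exp_log (hpos i (by simpa using hi))]
  have hgp : 2 * (μ - p) ^ 2 ≤ g := by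
    obtain ⟨y, hy, hy2⟩ := kmd_pinsker_prod m hm a ha μ p hμ0 hμ1 hpm (by linarith)
    have := hy2.trans (hmax y hy)
    rw [hFg, Real.exp_le_exp] at this
    exact le_of_mul_le_mul_left this hm0
  -- weights
  set r := l * S / m with hr
  have hr0 : 0 ≤ r := by positivity
  have hM : (∑ i ∈ Finset.range m, 1 / (1 + l * d i)) = m * (1 - r) := by
    have : ∑ i ∈ Finset.range m, 1 / (1 + l * d i) + l * S = m := by
      rw [hSdef, Finset.mul_sum, ← Finset.sum_add_distrib]
      rw [Finset.sum_congr rfl (g := fun _ => (1:ℝ))]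
      · simp
      · intro i hi
        have := hpos i (by simpa using hi)
        field_simp
    rw [hr]; field_simp; linarith
  have hA : (∑ i ∈ Finset.range m, a i / (1 + l * d i)) = m * (μ - r) := by
    have h1 : ∑ i ∈ Finset.range m, a i / (1 + l * d i)
        = μ * ∑ i ∈ Finset.range m, 1 / (1 + l * d i) - (1 - μ) * S := by
      rw [hSdef, Finset.mul_sum, Finset.mul_sum, ← Finset.sum_sub_distrib]
      apply Finset.sum_congr rfl
      intro i hi
      have hai : a i = μ - (1 - μ) * d i := by rw [hd]; field_simp; ring
      have hp := hpos i (by simpa using hi)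
      generalize d i = e at hai hp
      rw [hai]
      ring
    rw [h1, hM]
    have : m * r = S := by
      have : m * r = l * S := by rw [hr]; field_simp
      linarith
    nlinarith
  have main : ∀ α : ℝ, α ≤ 1 → (μ - x - p) / (μ - p) < α → u ≤ α * g := by
    intro α hα1 hα
    have hD : 0 < μ - p := by linarith
    have hα0 : 0 < α := lt_of_le_of_lt (div_nonneg (by linarith) hD.le) hα
    rw [div_lt_iff₀ hD] at hα
    set w : ℝ → ℝ := fun y => 1 - α + α / (1 + l * ((μ - y) / (1 - μ))) with hw
    have hwm : Measurable w := by fun_prop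
    have hwa : ∀ i, w (a i) = (1 - α) + α * (1 / (1 + l * d i)) := by
      intro i; simp [hw, hd]; ring
    have hwpos : ∀ i, i < m → 0 < w (a i) := by
      intro i hi
      rw [hwa]
      have := hpos i hi
      have : 0 ≤ 1 - α := by linarith
      positivity
    have h1 := kmd_Kinf_le (kmdEmp a m) hs hall w hwm (kmdEmp_ae a m (fun y => 0 < w y) hwpos)
      (α * r) (μ - x) (by positivity)
      (by
        rw [kmdEmp_integral]
        simp only [hwa]
        rw [Finset.sum_add_distrib, ← Finset.mul_sum, hM]
        simp only [Finset.sum_const, Finset.card_range, nsmul_eq_mul]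
        field_simp
        ring)
      (by
        rw [kmdEmp_integral]
        simp only [hwa]
        have : ∑ i ∈ Finset.range m, (1 - α + α * (1 / (1 + l * d i))) * a i
            = (1 - α) * (m * p) + α * (m * (μ - r)) := by
          rw [← hpm, ← hA, Finset.mul_sum, Finset.mul_sum, ← Finset.sum_add_distrib]
          apply Finset.sum_congr rfl
          intro i _
          ring
        rw [this]
        have : ((1 - α) * (m * p) + α * (m * (μ - r))) / m = (1 - α) * p + α * (μ - r) := by
          field_simp
        rw [this]
        nlinarith)
    have h2 := (hK.trans_le h1)
    rw [kmdEmp_integral] at h2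
    have h3 : (∑ i ∈ Finset.range m, -Real.log (w (a i))) / m ≤ α * g := by
      rw [hg, ← mul_div_assoc, Finset.mul_sum]
      apply div_le_div_of_nonneg_right _ hm0.le
      apply Finset.sum_le_sum
      intro i hi
      have hp := hpos i (by simpa using hi)
      have hc := strictConcaveOn_log_Ioi.concaveOn.2 (Set.mem_Ioi.2 one_pos)
        (Set.mem_Ioi.2 (one_div_pos.2 hp)) (sub_nonneg.2 hα1) hα0.le (by ring)
      simp only [smul_eq_mul, mul_one, Real.log_one, mul_zero, zero_add, one_div,
        Real.log_inv] at hc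
      rw [hwa, one_div]
      linarith
    have h4 := h2.le.trans (ENNReal.ofReal_le_ofReal h3)
    rwa [ENNReal.ofReal_le_ofReal_iff] at h4
    have : 0 ≤ g := le_trans (by positivity) hgp
    positivity
  have hD : 0 < μ - p := by linarith
  have hfin : u ≤ (μ - x - p) / (μ - p) * g := by
    have hlt : (μ - x - p) / (μ - p) < 1 := by rw [div_lt_one hD]; linarith
    have ht : Filter.Tendsto (fun α : ℝ => α * g)
        (nhdsWithin ((μ - x - p) / (μ - p)) (Set.Ioi ((μ - x - p) / (μ - p))))
        (nhds ((μ - x - p) / (μ - p) * g)) := by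
      apply Filter.Tendsto.mono_left _ nhdsWithin_le_nhds
      exact (continuous_id.mul continuous_const).tendsto _
    apply ge_of_tendsto ht
    filter_upwards [Ioc_mem_nhdsGT hlt] with α hα
    exact main α hα.2 hα.1
  rw [hFg]
  apply Real.exp_le_exp.2
  apply mul_le_mul_of_nonneg_left _ hm0.le
  have h5 : (μ - x - p) / (μ - p) * g = g - x * (g / (μ - p)) := by field_simp; ring
  have h6 : 2 * (μ - p) ≤ g / (μ - p) := by
    rw [le_div_iff₀ hD]; nlinarith
  rw [h5] at hfin
  nlinarith

lemma kmd_prob {Ω : Type*} [MeasurableSpace Ω]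
    (P : Measure Ω) [IsProbabilityMeasure P]
    (ν : Measure ℝ) [IsProbabilityMeasure ν] (hsupp : ν (Set.Icc (0:ℝ) 1)ᶜ = 0)
    (hmean : (∫ y, y ∂ν) ∈ Set.Ioo (0:ℝ) 1)
    (X : ℕ → Ω → ℝ) (hmeas : ∀ i, Measurable (X i))
    (hindep : iIndepFun X P)
    (hdist : ∀ i, Measure.map (X i) P = ν)
    (x : ℝ) (hx : x ∈ Set.Ioo 0 (∫ y, y ∂ν)) (m : ℕ) (hm : 1 ≤ m) (u : ℝ) (hu : 0 ≤ u) :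
    P {ω | ENNReal.ofReal u < Kinf (empSeq X m ω) ((∫ y, y ∂ν) - x)}
      ≤ ENNReal.ofReal ((m + 1) * Real.exp (-(m * (u + 2 * x ^ 2)))) := by
  set μ := ∫ y, y ∂ν with hμ
  have h1μ : 0 < 1 - μ := by linarith [hmean.2]
  have hae : ∀ᵐ y ∂ν, y ∈ Set.Icc (0:ℝ) 1 := hsupp
  set b : ℝ → ℝ≥0∞ := fun y => ENNReal.ofReal ((1 - y) / (1 - μ)) with hb
  have hbm : Measurable b := by fun_prop
  have hXae : ∀ᵐ ω ∂P, ∀ i, X i ω ∈ Set.Icc (0:ℝ) 1 := by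
    rw [ae_all_iff]
    intro i
    have : ∀ᵐ y ∂(Measure.map (X i) P), y ∈ Set.Icc (0:ℝ) 1 := by rw [hdist i]; exact hae
    exact ae_of_ae_map (hmeas i).aemeasurable this
  have hyint : Integrable (fun y : ℝ => y) ν := by
    apply Integrable.of_bound (C := 1) (by fun_prop)
    filter_upwards [hae] with y hy
    rw [Real.norm_of_nonneg hy.1]; exact hy.2
  have hbint : ∫⁻ y, b y ∂ν = 1 := by
    rw [hb, ← ofReal_integral_eq_lintegral_ofReal]
    · rw [integral_div, integral_sub (integrable_const _) hyint]
      simp [← hμ, div_self h1μ.ne']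
    · exact ((integrable_const _).sub hyint).div_const _
    · filter_upwards [hae] with y hy
      exact div_nonneg (by linarith [hy.2]) h1μ.le
  have hbi : ∀ i, ∫⁻ ω, b (X i ω) ∂P = 1 := by
    intro i
    rw [← lintegral_map hbm (hmeas i), hdist i, hbint]
  set Z : Ω → ℝ≥0∞ := fun ω => ∑ S ∈ (Finset.range m).powerset,
    ENNReal.ofReal ((m.choose S.card : ℝ)⁻¹) * ∏ i ∈ S, b (X i ω) with hZ
  have hprodm : ∀ S : Finset ℕ, Measurable fun ω => ∏ i ∈ S, b (X i ω) :=
    fun S => Finset.measurable_fun_prod S fun i _ => hbm.comp (hmeas i)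
  have hZm : Measurable Z :=
    Finset.measurable_fun_sum _ fun S _ => (hprodm S).const_mul _
  have hZint : ∫⁻ ω, Z ω ∂P = ENNReal.ofReal (m + 1) := by
    rw [hZ, lintegral_finsetSum _ (fun S _ => (hprodm S).const_mul _)]
    rw [← kmd_sum_choose, ENNReal.ofReal_sum_of_nonneg (fun S _ => by positivity)]
    apply Finset.sum_congr rfl
    intro S _
    rw [lintegral_const_mul _ (hprodm S),
      lintegral_prod_eq_prod_lintegral_of_indepFun S (fun i ω => b (X i ω))
        (hindep.comp (fun _ => b) (fun _ => hbm)) (fun i => hbm.comp (hmeas i))]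
    simp [hbi]
  set ε := Real.exp (m * (u + 2 * x ^ 2)) with hε
  have hε0 : 0 < ε := Real.exp_pos _
  calc P {ω | ENNReal.ofReal u < Kinf (empSeq X m ω) (μ - x)}
      ≤ P {ω | ENNReal.ofReal ε ≤ Z ω} := by
        apply measure_mono_ae
        filter_upwards [hXae] with ω hω hK
        change ENNReal.ofReal u < Kinf (empSeq X m ω) (μ - x) at hK
        change ENNReal.ofReal ε ≤ Z ω
        obtain ⟨l, hl, hle⟩ := kmd_det m hm (fun i => X i ω) (fun i _ => hω i) μ x u hmean.2
          hx.1 hx.2 hu hK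
        have hfac : ∀ i, 1 + l * ((μ - X i ω) / (1 - μ))
            = l * ((1 - X i ω) / (1 - μ)) + (1 - l) := by
          intro i; field_simp; ring
        simp only [hfac] at hle
        have hbn : ∀ i, 0 ≤ (1 - X i ω) / (1 - μ) :=
          fun i => div_nonneg (by linarith [(hω i).2]) h1μ.le
        have h2 := hle.trans (kmd_cover m (fun i => (1 - X i ω) / (1 - μ))
          (fun i _ => hbn i) l hl.1 hl.2)
        refine (ENNReal.ofReal_le_ofReal h2).trans (le_of_eq ?_)
        rw [ENNReal.ofReal_sum_of_nonneg (fun S _ => mul_nonneg (by positivity)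
          (Finset.prod_nonneg fun i _ => hbn i))]
        apply Finset.sum_congr rfl
        intro S _
        rw [ENNReal.ofReal_mul (by positivity), ENNReal.ofReal_prod_of_nonneg (fun i _ => hbn i)]
    _ ≤ (∫⁻ ω, Z ω ∂P) / ENNReal.ofReal ε :=
        meas_ge_le_lintegral_div hZm.aemeasurable (by simpa using hε0) ENNReal.ofReal_ne_top
    _ = _ := by
        rw [hZint, ← ENNReal.ofReal_div_of_pos hε0, Real.exp_neg, ← hε, div_eq_mul_inv]


/-- Maximal deviation bound: for i.i.d. `X_1, X_2, …` with distribution `ν` on `[0,1]`,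
`E(ν) ∈ (0,1)`, `x ∈ (0, E(ν))` and integers `1 ≤ K ≤ T`,
`P[∃ m ≤ ⌊T/K⌋, K_inf(ν̂_m, E(ν) − x) > (1/m) ln(T/(Km))] ≤ (eK/T) ⋅ 5/(1 − e^{−2x²})³`. -/
theorem kinf_maximal_deviation {Ω : Type*} [MeasurableSpace Ω]
    (P : Measure Ω) [IsProbabilityMeasure P]
    (ν : Measure ℝ) [IsProbabilityMeasure ν] (hsupp : ν (Set.Icc (0:ℝ) 1)ᶜ = 0)
    (hmean : (∫ y, y ∂ν) ∈ Set.Ioo (0:ℝ) 1)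
    (X : ℕ → Ω → ℝ) (hmeas : ∀ i, Measurable (X i))
    (hindep : iIndepFun X P)
    (hdist : ∀ i, Measure.map (X i) P = ν)
    (x : ℝ) (hx : x ∈ Set.Ioo 0 (∫ y, y ∂ν))
    (K T : ℕ) (hK : 1 ≤ K) (hKT : K ≤ T) :
    P {ω | ∃ m : ℕ, 1 ≤ m ∧ m ≤ T / K ∧
        ENNReal.ofReal (1 / m * Real.log ((T : ℝ) / (K * m)))
          < Kinf (empSeq X m ω) ((∫ y, y ∂ν) - x)}
      ≤ ENNReal.ofReal
          (Real.exp 1 * K / T * (5 / (1 - Real.exp (-2 * x ^ 2)) ^ 3)) := by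

  have hK0 : (0:ℝ) < K := by exact_mod_cast hK
  have hT0 : (0:ℝ) < T := by exact_mod_cast (hK.trans hKT)
  set q := Real.exp (-2 * x ^ 2) with hq
  have hq0 : 0 < q := Real.exp_pos _
  have hq1 : q < 1 := by
    rw [hq, Real.exp_lt_one_iff]
    have := hx.1
    nlinarith [pow_pos this 2]
  calc _ ≤ P (⋃ m ∈ Finset.Icc 1 (T / K), {ω |
        ENNReal.ofReal (1 / m * Real.log ((T : ℝ) / (K * m)))
          < Kinf (empSeq X m ω) ((∫ y, y ∂ν) - x)}) := by
        apply measure_mono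
        rintro ω ⟨m, h1, h2, h3⟩
        simp only [Set.mem_iUnion]
        exact ⟨m, Finset.mem_Icc.2 ⟨h1, h2⟩, h3⟩
    _ ≤ ∑ m ∈ Finset.Icc 1 (T / K), P {ω |
        ENNReal.ofReal (1 / m * Real.log ((T : ℝ) / (K * m)))
          < Kinf (empSeq X m ω) ((∫ y, y ∂ν) - x)} := measure_biUnion_finset_le _ _
    _ ≤ ∑ m ∈ Finset.Icc 1 (T / K), ENNReal.ofReal (K / T * (((m:ℝ) + 1) * m * q ^ m)) := by
        apply Finset.sum_le_sum
        intro m hm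
        rw [Finset.mem_Icc] at hm
        have hm0 : (0:ℝ) < m := by exact_mod_cast hm.1
        have hKm : (K:ℝ) * m ≤ T := by
          have : K * m ≤ T := (Nat.mul_le_mul_left K hm.2).trans (Nat.mul_div_le T K)
          exact_mod_cast this
        have hKm0 : 0 < (K:ℝ) * m := by positivity
        refine (kmd_prob P ν hsupp hmean X hmeas hindep hdist x hx m hm.1 _ ?_).trans (le_of_eq ?_)
        · apply mul_nonneg (by positivity)
          exact Real.log_nonneg ((one_le_div hKm0).2 hKm)
        · congr 1
          have : -((m:ℝ) * (1 / m * Real.log ((T : ℝ) / (K * m)) + 2 * x ^ 2))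
              = Real.log ((K * m) / T) + m * (-2 * x ^ 2) := by
            rw [← inv_div (T:ℝ) (K * m), Real.log_inv]
            field_simp
            ring
          rw [this, Real.exp_add, Real.exp_log (by positivity), Real.exp_nat_mul, ← hq]
          field_simp
    _ = ENNReal.ofReal (K / T * ∑ m ∈ Finset.Icc 1 (T / K), (((m:ℝ) + 1) * m * q ^ m)) := by
        rw [Finset.mul_sum, ENNReal.ofReal_sum_of_nonneg (fun _ _ => by positivity)]
    _ ≤ _ := by
        apply ENNReal.ofReal_le_ofReal
        have h1 := kmd_sum_geom q hq0.le hq1 (T / K)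
        have hd : 0 < (1 - q) ^ 3 := pow_pos (by linarith) 3
        have he : 1 ≤ Real.exp 1 := Real.one_le_exp zero_le_one
        calc _ ≤ (K:ℝ) / T * (2 / (1 - q) ^ 3) := by gcongr
          _ ≤ 1 * (K / T) * (5 / (1 - q) ^ 3) := by rw [one_mul]; gcongr; norm_num
          _ ≤ Real.exp 1 * (K / T) * (5 / (1 - q) ^ 3) := by gcongr
          _ = _ := by ring
end
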